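/- arXiv:2002.05859 — 2 statements merged into one kernel-verified Lean document; each statement's English description precedes it below -/
import Mathlib

section
/- Let V be an n-dimensional vector space over 𝔽_q with m ≥ 3, and let ℱ be a nonempty intersecting family of m-dimensional subspaces of V with covering number τ(ℱ) = m. Let X = Σ_{F ∈ ℱ} F. If dim(X) ≥ 2m, then |ℱ| ≤ [m−1 over 1]_q · [m over 1]_q^{m−1} + [m−1 over 1]_q² · [2m−3 over m−2]_q. -/
open Module

/-- The Gaussian binomial coefficient `[n over m]_q`, as a rational number. -/
def gaussBinom (q n m : ℕ) : ℚ :=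
  ∏ i ∈ Finset.range m, ((q : ℚ) ^ (n - i) - 1) / ((q : ℚ) ^ (m - i) - 1)

/-- A family of subspaces is intersecting if any two of its members have intersection
of dimension at least 1. -/
def IsIntersectingFamily {F V : Type*} [Field F] [AddCommGroup V] [Module F V]
    (𝒜 : Set (Submodule F V)) : Prop :=
  ∀ A ∈ 𝒜, ∀ B ∈ 𝒜, 1 ≤ finrank F ↥(A ⊓ B)

/-- The covering number of a family of subspaces: the minimum dimension of a subspace
intersecting every member of the family. -/
noncomputable def coveringNumber {F V : Type*} [Field F] [AddCommGroup V] [Module F V]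
    (𝒜 : Set (Submodule F V)) : ℕ :=
  sInf { d : ℕ | ∃ W : Submodule F V, finrank F ↥W = d ∧ ∀ A ∈ 𝒜, 1 ≤ finrank F ↥(W ⊓ A) }

theorem gaussBinom_nonneg (q n m : ℕ) (hq : 2 ≤ q) : 0 ≤ gaussBinom q n m := by
  refine Finset.prod_nonneg fun i _ => div_nonneg ?_ ?_ <;>
    exact sub_nonneg.2 (one_le_pow₀ (by exact_mod_cast (by lia : 1 ≤ q)))

theorem gaussBinom_one_right (q n : ℕ) (hq : 2 ≤ q) :
    gaussBinom q n 1 = ((∑ i ∈ Finset.range n, q ^ i : ℕ) : ℚ) := by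
  have h : (q : ℚ) ≠ 1 := by exact_mod_cast (by lia : q ≠ 1)
  simp [gaussBinom, geom_sum_eq h]

section Dimension

variable {F V : Type*} [Field F] [AddCommGroup V] [Module F V]

theorem exists_point_le {W : Submodule F V} (hW : W ≠ ⊥) : ∃ x ≤ W, finrank F x = 1 := by
  obtain ⟨v, hv, h0⟩ := Submodule.exists_mem_ne_zero_of_ne_bot hW
  exact ⟨Submodule.span F {v}, by simpa using hv, finrank_span_singleton h0⟩

variable [FiniteDimensional F V]

theorem finrank_map_mkQ_add {L E : Submodule F V} (h : L ≤ E) :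
    finrank F (E.map L.mkQ) + finrank F L = finrank F E := by
  have := LinearMap.finrank_range_add_finrank_ker (L.mkQ.domRestrict E)
  rw [LinearMap.range_domRestrict, LinearMap.ker_domRestrict, Submodule.ker_mkQ] at this
  rwa [LinearEquiv.finrank_eq (Submodule.comapSubtypeEquivOfLe h)] at this

theorem finrank_sup_point {S W x : Submodule F V} (hSW : S ⊓ W = ⊥) (hx : x ≤ W)
    (hx1 : finrank F x = 1) : finrank F ↥(S ⊔ x) = finrank F S + 1 := by
  have h := Submodule.finrank_sup_add_finrank_inf_eq S x
  rw [eq_bot_iff.2 ((inf_le_inf_left S hx).trans hSW.le), finrank_bot, hx1] at h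
  exact h

theorem finrank_inf_le_of_not_le {A Y : Submodule F V} {m : ℕ}
    (hA : finrank F A = m) (h : ¬ A ≤ Y) :
    finrank F ↥(A ⊓ Y) ≤ m - 1 := by
  have : A ⊓ Y < A := inf_lt_left.2 h
  have := Submodule.finrank_lt_finrank_of_lt this
  lia

end Dimension

section Counting

variable {F V : Type*} [Field F] [Fintype F] [AddCommGroup V] [Module F V]
  [FiniteDimensional F V]

theorem finite_submodule : Finite (Submodule F V) :=
  have : Finite V := Module.finite_of_finite F
  Finite.of_injective (fun W : Submodule F V => (W : Set V)) SetLike.coe_injective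

theorem ncard_submodule_mul_le (Y : Submodule F V) {k : ℕ} (hk : k ≤ finrank F Y) :
    {W : Submodule F V | W ≤ Y ∧ finrank F W = k}.ncard *
        ∏ i : Fin k, (Fintype.card F ^ k - Fintype.card F ^ i.val) ≤
      ∏ i : Fin k, (Fintype.card F ^ finrank F Y - Fintype.card F ^ i.val) := by
  have : Finite V := Module.finite_of_finite F
  have : Finite (Submodule F V) := finite_submodule
  let S := {W : Submodule F V | W ≤ Y ∧ finrank F W = k}
  have hS (W : S) : Nat.card {s : Fin k → W.1 // LinearIndependent F s} =
      ∏ i : Fin k, (Fintype.card F ^ k - Fintype.card F ^ i.val) := by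
    rw [card_linearIndependent W.2.2.ge, W.2.2]
  let f : (Σ W : S, {s : Fin k → W.1 // LinearIndependent F s}) →
      {s : Fin k → Y // LinearIndependent F s} := fun p =>
    ⟨fun i => Submodule.inclusion p.1.2.1 (p.2.1 i),
      p.2.2.map' _ (LinearMap.ker_eq_bot.2 (Submodule.inclusion_injective _))⟩
  have hspan (p : Σ W : S, {s : Fin k → W.1 // LinearIndependent F s}) :
      Submodule.span F (Set.range fun i => ((f p).1 i : V)) = p.1.1 := by
    have hli : LinearIndependent F fun i => ((p.2.1 i : p.1.1) : V) :=
      p.2.2.map' p.1.1.subtype (Submodule.ker_subtype _)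
    refine Submodule.eq_of_le_of_finrank_eq (Submodule.span_le.2 ?_) ?_
    · rintro _ ⟨i, rfl⟩
      exact (p.2.1 i).2
    · exact (finrank_span_eq_card hli).trans (by simpa using p.1.2.2.symm)
  have hf : Function.Injective f := by
    intro p p' h
    have hW : p.1 = p'.1 := Subtype.ext (by rw [← hspan p, ← hspan p', h])
    obtain ⟨W, s⟩ := p
    obtain ⟨W', s'⟩ := p'
    obtain rfl : W = W' := hW
    refine congrArg (Sigma.mk W) (Subtype.ext (funext fun i => Subtype.ext ?_))
    exact congrArg (fun t : {s : Fin k → Y // LinearIndependent F s} => ((t.1 i : Y) : V)) h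
  let _ : Fintype S := Fintype.ofFinite _
  have := Nat.card_le_card_of_injective f hf
  rwa [Nat.card_sigma, Finset.sum_congr rfl fun W _ => hS W, Finset.sum_const, smul_eq_mul,
    Finset.card_univ, ← Nat.card_eq_fintype_card, Nat.card_coe_set_eq,
    card_linearIndependent hk] at this

theorem ncard_submodule_le_gaussBinom (Y : Submodule F V) (k : ℕ) :
    ({W : Submodule F V | W ≤ Y ∧ finrank F W = k}.ncard : ℚ) ≤
      gaussBinom (Fintype.card F) (finrank F Y) k := by
  have hq : 1 < Fintype.card F := Fintype.one_lt_card
  have hq' : (1 : ℚ) < Fintype.card F := by exact_mod_cast hq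
  rcases le_or_gt k (finrank F Y) with hk | hk
  · have h := ncard_submodule_mul_le Y hk
    have hcast (d : ℕ) (hd : k ≤ d) :
        ((∏ i : Fin k, (Fintype.card F ^ d - Fintype.card F ^ i.val) : ℕ) : ℚ) =
          (∏ i ∈ Finset.range k, (Fintype.card F : ℚ) ^ i) *
            ∏ i ∈ Finset.range k, ((Fintype.card F : ℚ) ^ (d - i) - 1) := by
      rw [Fin.prod_univ_eq_prod_range (fun i => Fintype.card F ^ d - Fintype.card F ^ i),
        ← Finset.prod_mul_distrib, Nat.cast_prod]
      refine Finset.prod_congr rfl fun i hi => ?_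
      have hi : i < k := Finset.mem_range.1 hi
      rw [Nat.cast_sub (Nat.pow_le_pow_right hq.le (by lia)), mul_sub, ← pow_add,
        Nat.add_sub_cancel' (by lia)]
      simp
    have h' := (Nat.cast_le (α := ℚ)).2 h
    rw [Nat.cast_mul, hcast _ le_rfl, hcast _ hk, mul_left_comm] at h'
    have hpos : 0 < ∏ i ∈ Finset.range k, ((Fintype.card F : ℚ) ^ (k - i) - 1) :=
      Finset.prod_pos fun i hi => sub_pos.2
        (one_lt_pow₀ hq' (Nat.sub_ne_zero_of_lt (Finset.mem_range.1 hi)))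
    rw [gaussBinom, Finset.prod_div_distrib, le_div_iff₀ hpos]
    exact le_of_mul_le_mul_left h' (Finset.prod_pos fun i _ => by positivity)
  · have : {W : Submodule F V | W ≤ Y ∧ finrank F W = k} = ∅ :=
      Set.eq_empty_of_forall_notMem fun W hW =>
        hk.not_ge (hW.2 ▸ Submodule.finrank_mono hW.1)
    rw [this]
    simpa using gaussBinom_nonneg _ _ _ hq

theorem ncard_points_le (Y : Submodule F V) :
    {x : Submodule F V | x ≤ Y ∧ finrank F x = 1}.ncard ≤
      ∑ i ∈ Finset.range (finrank F Y), Fintype.card F ^ i := by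
  have h := ncard_submodule_le_gaussBinom Y 1
  rw [gaussBinom_one_right _ _ Fintype.one_lt_card] at h
  exact_mod_cast h

theorem ncard_submodule_Icc_le_gaussBinom (L Y : Submodule F V) (k : ℕ) :
    ({E : Submodule F V | (L ≤ E ∧ E ≤ Y) ∧ finrank F E = finrank F L + k}.ncard : ℚ) ≤
      gaussBinom (Fintype.card F) (finrank F Y - finrank F L) k := by
  by_cases hLY : L ≤ Y
  · have hY : finrank F (Y.map L.mkQ) = finrank F Y - finrank F L := by
      have := finrank_map_mkQ_add hLY
      lia
    have : Finite (Submodule F (V ⧸ L)) := finite_submodule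
    rw [← hY]
    refine le_trans (Nat.cast_le.2 ?_) (ncard_submodule_le_gaussBinom (Y.map L.mkQ) k)
    refine Set.ncard_le_ncard_of_injOn (Submodule.map L.mkQ) ?_ ?_ (Set.toFinite _)
    · rintro E ⟨⟨hL, hE⟩, hd⟩
      have := finrank_map_mkQ_add hL
      exact ⟨Submodule.map_mono hE, by lia⟩
    · rintro E ⟨⟨hL, -⟩, -⟩ E' ⟨⟨hL', -⟩, -⟩ h
      have := congrArg (Submodule.comap L.mkQ) h
      simpa [Submodule.comap_map_mkQ, hL, hL'] using this
  · have : {E : Submodule F V | (L ≤ E ∧ E ≤ Y) ∧ finrank F E = finrank F L + k} = ∅ :=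
      Set.eq_empty_of_forall_notMem fun E hE => hLY (hE.1.1.trans hE.1.2)
    rw [this]
    simpa using gaussBinom_nonneg _ _ _ Fintype.one_lt_card

theorem ncard_le_of_forall_inf_ne_bot {𝒢 : Set (Submodule F V)} {W : Submodule F V} {w c : ℕ}
    (hw : finrank F W ≤ w) (hmeet : ∀ E ∈ 𝒢, E ⊓ W ≠ ⊥)
    (hc : ∀ x ≤ W, finrank F x = 1 → {E ∈ 𝒢 | x ≤ E}.ncard ≤ c) :
    𝒢.ncard ≤ (∑ i ∈ Finset.range w, Fintype.card F ^ i) * c := by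
  have : Finite (Submodule F V) := finite_submodule
  let P := {x : Submodule F V | x ≤ W ∧ finrank F x = 1}
  have hP : P.ncard ≤ ∑ i ∈ Finset.range w, Fintype.card F ^ i :=
    (ncard_points_le W).trans
      (Finset.sum_le_sum_of_subset (Finset.range_subset_range.2 hw))
  have hcov : 𝒢 ⊆ ⋃ x ∈ (Set.toFinite P).toFinset, {E ∈ 𝒢 | x ≤ E} := by
    intro E hE
    obtain ⟨x, hx, hx1⟩ := exists_point_le (hmeet E hE)
    simp only [Set.Finite.mem_toFinset, Set.mem_iUnion]
    exact ⟨x, ⟨hx.trans inf_le_right, hx1⟩, hE, hx.trans inf_le_left⟩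
  calc 𝒢.ncard ≤ (⋃ x ∈ (Set.toFinite P).toFinset, {E ∈ 𝒢 | x ≤ E}).ncard :=
        Set.ncard_le_ncard hcov (Set.toFinite _)
    _ ≤ ∑ x ∈ (Set.toFinite P).toFinset, {E ∈ 𝒢 | x ≤ E}.ncard :=
        Finset.set_ncard_biUnion_le _ _
    _ ≤ (Set.toFinite P).toFinset.card • c :=
        Finset.sum_le_card_nsmul _ _ _ fun x hx => by
          have hx := (Set.Finite.mem_toFinset _).1 hx
          exact hc x hx.1 hx.2
    _ ≤ _ := by
        rw [smul_eq_mul, ← Set.ncard_eq_toFinset_card P]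
        exact Nat.mul_le_mul_right _ hP

section Branching

variable {ℱ : Set (Submodule F V)} {m : ℕ} (hdim : ∀ A ∈ ℱ, finrank F A = m)
  (hint : ∀ A ∈ ℱ, ∀ B ∈ ℱ, A ⊓ B ≠ ⊥)
  (hcov : ∀ W : Submodule F V, finrank F W < m → ∃ A ∈ ℱ, W ⊓ A = ⊥)

include hdim hint in
theorem ncard_above_le_mul_of_inf_eq_bot {S G : Submodule F V} {c : ℕ} (hG : G ∈ ℱ)
    (hSG : S ⊓ G = ⊥)
    (hc : ∀ T : Submodule F V, finrank F T = finrank F S + 1 → {E ∈ ℱ | T ≤ E}.ncard ≤ c) :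
    {E ∈ ℱ | S ≤ E}.ncard ≤ (∑ i ∈ Finset.range m, Fintype.card F ^ i) * c := by
  refine ncard_le_of_forall_inf_ne_bot (hdim G hG).le (fun E hE => hint E hE.1 G hG) ?_
  intro x hx hx1
  convert hc (S ⊔ x) (finrank_sup_point hSG hx hx1) using 2
  ext E
  simp [and_assoc]

include hdim hint hcov in
theorem ncard_above_le_pow {k c : ℕ} (hk : k ≤ m)
    (hc : ∀ T : Submodule F V, finrank F T = k → {E ∈ ℱ | T ≤ E}.ncard ≤ c) (j : ℕ) :
    ∀ S : Submodule F V, finrank F S + j = k →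
      {E ∈ ℱ | S ≤ E}.ncard ≤ (∑ i ∈ Finset.range m, Fintype.card F ^ i) ^ j * c := by
  induction j with
  | zero => simpa using hc
  | succ j ih =>
    intro S hS
    obtain ⟨G, hG, hSG⟩ := hcov S (by lia)
    rw [pow_succ', mul_assoc]
    exact ncard_above_le_mul_of_inf_eq_bot hdim hint hG hSG fun T hT => ih T (by lia)

include hdim in
theorem ncard_above_le_one (T : Submodule F V) (hT : finrank F T = m) :
    {E ∈ ℱ | T ≤ E}.ncard ≤ 1 := by
  have : Finite (Submodule F V) := finite_submodule
  refine (Set.ncard_le_one (Set.toFinite _)).2 ?_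
  rintro E ⟨hE, hTE⟩ E' ⟨hE', hTE'⟩
  rw [← Submodule.eq_of_le_of_finrank_eq hTE (hT.trans (hdim E hE).symm),
    Submodule.eq_of_le_of_finrank_eq hTE' (hT.trans (hdim E' hE').symm)]

include hdim hint hcov in
theorem ncard_above_le (S : Submodule F V) {j : ℕ} (hS : finrank F S + j = m) :
    {E ∈ ℱ | S ≤ E}.ncard ≤ (∑ i ∈ Finset.range m, Fintype.card F ^ i) ^ j := by
  simpa using ncard_above_le_pow hdim hint hcov le_rfl (ncard_above_le_one hdim) j S hS

include hdim hint in
theorem ncard_above_hyperplane_le {S G₁ G₂ : Submodule F V} (hS : finrank F S + 1 = m)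
    (hG₁ : G₁ ∈ ℱ) (hG₂ : G₂ ∈ ℱ) (hSG₁ : S ⊓ G₁ = ⊥) (hSG₂ : S ⊓ G₂ = ⊥)
    (hG : ¬ G₂ ≤ S ⊔ G₁) :
    {E ∈ ℱ | S ≤ E}.ncard ≤ ∑ i ∈ Finset.range (m - 1), Fintype.card F ^ i := by
  rw [← mul_one (∑ i ∈ _, _)]
  refine ncard_le_of_forall_inf_ne_bot (W := G₂ ⊓ (S ⊔ G₁))
    (finrank_inf_le_of_not_le (hdim G₂ hG₂) hG) ?_ ?_
  · rintro E ⟨hE, hSE⟩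
    obtain ⟨x, hx, hx1⟩ := exists_point_le (hint E hE G₁ hG₁)
    have hES : S ⊔ x = E := by
      refine Submodule.eq_of_le_of_finrank_eq (sup_le hSE (hx.trans inf_le_left)) ?_
      rw [finrank_sup_point hSG₁ (hx.trans inf_le_right) hx1, hS, hdim E hE]
    have hEY : E ≤ S ⊔ G₁ := hES ▸ sup_le_sup_left (hx.trans inf_le_right) S
    rw [inf_left_comm, inf_eq_left.2 hEY, inf_comm]
    exact hint E hE G₂ hG₂
  · intro x hx hx1
    convert ncard_above_le_one hdim (S ⊔ x)
      ((finrank_sup_point hSG₂ (hx.trans inf_le_left) hx1).trans hS) using 2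
    ext E
    simp [and_assoc]

include hint in
theorem ncard_below_le {A Y : Submodule F V} {K a b : ℕ}
    (ha : finrank F ↥(A ⊓ Y) ≤ a) (hA : A ∈ ℱ)
    (hb : ∀ x : Submodule F V, finrank F x = 1 → ∃ B ∈ ℱ, x ⊓ B = ⊥ ∧ finrank F ↥(B ⊓ Y) ≤ b)
    (hK : ∀ L : Submodule F V, finrank F L = 2 → {E ∈ ℱ | L ≤ E ∧ E ≤ Y}.ncard ≤ K) :
    {E ∈ ℱ | E ≤ Y}.ncard ≤ (∑ i ∈ Finset.range a, Fintype.card F ^ i) *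
      ((∑ i ∈ Finset.range b, Fintype.card F ^ i) * K) := by
  have hmeet : ∀ A ∈ ℱ, ∀ E ∈ ℱ, E ≤ Y → E ⊓ (A ⊓ Y) ≠ ⊥ := by
    intro A hA E hE hEY
    rw [inf_left_comm, inf_eq_left.2 hEY, inf_comm]
    exact hint E hE A hA
  refine ncard_le_of_forall_inf_ne_bot ha (fun E hE => hmeet A hA E hE.1 hE.2) ?_
  intro x hx hx1
  obtain ⟨B, hB, hxB, hBY⟩ := hb x hx1
  refine ncard_le_of_forall_inf_ne_bot hBY (fun E hE => hmeet B hB E hE.1.1 hE.1.2) ?_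
  intro z hz hz1
  convert hK (x ⊔ z) (by rw [finrank_sup_point hxB (hz.trans inf_le_left) hz1, hx1]) using 2
  ext E
  simp only [Set.mem_ofPred_eq, sup_le_iff]
  tauto

theorem ncard_le_add_of_subset_union {X : Type*} [Finite X] {s t u : Set X} (h : s ⊆ t ∪ u) :
    s.ncard ≤ t.ncard + u.ncard :=
  (Set.ncard_le_ncard h (Set.toFinite _)).trans (Set.ncard_union_le _ _)

theorem geom_sum_le_sq_geom_sum (q m : ℕ) (hq : 2 ≤ q) (hm : 3 ≤ m) :
    ∑ i ∈ Finset.range m, q ^ i ≤ (∑ i ∈ Finset.range (m - 1), q ^ i) ^ 2 := by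
  obtain ⟨k, rfl⟩ : ∃ k, m = k + 3 := ⟨m - 3, by lia⟩
  have h2 : q + 1 ≤ ∑ i ∈ Finset.range (k + 2), q ^ i := by
    rw [Finset.sum_range_succ', Finset.sum_range_succ']
    simp
  rw [geom_sum_succ, show k + 3 - 1 = k + 2 by lia]
  nlinarith

include hdim hint hcov in
theorem ncard_le_of_two_mul_le_finrank_sSup {K : ℕ} (hm : 3 ≤ m)
    (hX : 2 * m ≤ finrank F ↥(sSup ℱ))
    (hKb : K ≤ (∑ i ∈ Finset.range m, Fintype.card F ^ i) ^ (m - 2))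
    (hK : ∀ L Y : Submodule F V, finrank F L = 2 → finrank F Y = 2 * m - 1 →
      {E ∈ ℱ | L ≤ E ∧ E ≤ Y}.ncard ≤ K) :
    ℱ.ncard ≤ (∑ i ∈ Finset.range (m - 1), Fintype.card F ^ i) *
        (∑ i ∈ Finset.range m, Fintype.card F ^ i) ^ (m - 1) +
      (∑ i ∈ Finset.range (m - 1), Fintype.card F ^ i) ^ 2 * K := by
  have : Finite (Submodule F V) := finite_submodule
  have hab := geom_sum_le_sq_geom_sum (Fintype.card F) m Fintype.one_lt_card hm
  have hab' : ∑ i ∈ Finset.range (m - 1), Fintype.card F ^ i ≤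
      ∑ i ∈ Finset.range m, Fintype.card F ^ i :=
    Finset.sum_le_sum_of_subset (Finset.range_subset_range.2 (Nat.sub_le _ _))
  by_cases hgood : ∀ S Y : Submodule F V, finrank F S + 1 = m → finrank F Y = 2 * m - 1 →
      ∃ G ∈ ℱ, S ⊓ G = ⊥ ∧ ¬ G ≤ Y
  · have hc (T : Submodule F V) (hT : finrank F T = m - 1) :
        {E ∈ ℱ | T ≤ E}.ncard ≤ ∑ i ∈ Finset.range (m - 1), Fintype.card F ^ i := by
      obtain ⟨G₁, hG₁, hTG₁⟩ := hcov T (by lia)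
      have hsup := Submodule.finrank_sup_add_finrank_inf_eq T G₁
      rw [hTG₁, finrank_bot, hdim G₁ hG₁, hT] at hsup
      obtain ⟨G₂, hG₂, hTG₂, hG⟩ := hgood T (T ⊔ G₁) (by lia) (by lia)
      exact ncard_above_hyperplane_le hdim hint (by lia) hG₁ hG₂ hTG₁ hTG₂ hG
    have h := ncard_above_le_pow hdim hint hcov (Nat.sub_le m 1) hc (m - 1) ⊥ (by simp)
    simp only [bot_le, and_true, Set.ofPred_mem_eq] at h
    rw [mul_comm] at h
    exact h.trans (Nat.le_add_right _ _)
  push Not at hgood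
  obtain ⟨S, Y, hS, hY, hSY⟩ := hgood
  obtain ⟨A, hA, hAY⟩ : ∃ A ∈ ℱ, ¬ A ≤ Y := by
    by_contra! h
    have := Submodule.finrank_mono (sSup_le h)
    lia
  have hAY' := finrank_inf_le_of_not_le (hdim A hA) hAY
  by_cases hpt : ∃ x : Submodule F V, finrank F x = 1 ∧ ∀ E ∈ ℱ, ¬ E ≤ Y → x ⊓ E ≠ ⊥
  · obtain ⟨x, hx1, hx⟩ := hpt
    have hsub : ℱ ⊆ {E ∈ ℱ | x ≤ E} ∪ {E ∈ ℱ | E ≤ Y} := by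
      intro E hE
      by_cases hEY : E ≤ Y
      · exact Or.inr ⟨hE, hEY⟩
      · obtain ⟨z, hz, hz1⟩ := exists_point_le (hx E hE hEY)
        have hzx : z = x := Submodule.eq_of_le_of_finrank_eq (hz.trans inf_le_left)
          (hz1.trans hx1.symm)
        exact Or.inl ⟨hE, hzx ▸ hz.trans inf_le_right⟩
    have h₁ := ncard_le_add_of_subset_union hsub
    have h₂ := ncard_above_le hdim hint hcov x (j := m - 1) (by lia)
    have h₃ := ncard_below_le hint hAY' hA (b := m) (Y := Y) (fun x hx => by
      obtain ⟨B, hB, hxB⟩ := hcov x (by lia)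
      exact ⟨B, hB, hxB, (Submodule.finrank_mono inf_le_left).trans (hdim B hB).le⟩)
      (fun L hL => hK L Y hL hY)
    have hpow (b : ℕ) : b ^ (m - 1) = b ^ (m - 2) * b := by
      rw [← pow_succ, show m - 2 + 1 = m - 1 by lia]
    rw [hpow] at h₂ ⊢
    generalize (∑ i ∈ Finset.range m, Fintype.card F ^ i) ^ (m - 2) = B at *
    generalize ∑ i ∈ Finset.range (m - 1), Fintype.card F ^ i = a at *
    generalize ∑ i ∈ Finset.range m, Fintype.card F ^ i = b at *
    obtain ⟨d, rfl⟩ := Nat.exists_eq_add_of_le hab'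
    have h₄ : a * d * K ≤ a * d * B := Nat.mul_le_mul_left _ hKb
    have h₅ : (a + d) * B ≤ a ^ 2 * B := Nat.mul_le_mul_right _ hab
    nlinarith
  · push Not at hpt
    have hsub : ℱ ⊆ {E ∈ ℱ | E ⊓ S ≠ ⊥} ∪ {E ∈ ℱ | E ≤ Y} := by
      intro E hE
      by_cases hES : E ⊓ S = ⊥
      · exact Or.inr ⟨hE, hSY E hE (inf_comm E S ▸ hES)⟩
      · exact Or.inl ⟨hE, hES⟩
    have h₁ := ncard_le_add_of_subset_union hsub
    have h₂ : {E ∈ ℱ | E ⊓ S ≠ ⊥}.ncard ≤ _ :=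
      ncard_le_of_forall_inf_ne_bot (w := m - 1) (by lia) (fun E hE => hE.2) fun x _ hx1 =>
        (Set.ncard_le_ncard (t := {E ∈ ℱ | x ≤ E}) (fun E hE => ⟨hE.1.1, hE.2⟩)
          (Set.toFinite _)).trans
          (ncard_above_le hdim hint hcov x (j := m - 1) (by lia))
    have h₃ := ncard_below_le hint hAY' hA (b := m - 1) (Y := Y) (fun x hx => by
      obtain ⟨B, hB, hBY, hxB⟩ := hpt x hx
      exact ⟨B, hB, hxB, finrank_inf_le_of_not_le (hdim B hB) hBY⟩)
      (fun L hL => hK L Y hL hY)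
    rw [sq, mul_assoc]
    exact h₁.trans (add_le_add h₂ h₃)

end Branching

end Counting

theorem stmt6 {F V : Type*} [Field F] [Fintype F] [AddCommGroup V] [Module F V]
    [FiniteDimensional F V] {q m n : ℕ} (hq : Fintype.card F = q)
    (hm : 3 ≤ m) (hV : finrank F V = n)
    (ℱ : Set (Submodule F V)) (hne : ℱ.Nonempty)
    (hdim : ∀ A ∈ ℱ, finrank F ↥A = m)
    (hint : IsIntersectingFamily ℱ) (hτ : coveringNumber ℱ = m)
    (hX : 2 * m ≤ finrank F ↥(sSup ℱ)) :
    (ℱ.ncard : ℚ) ≤ gaussBinom q (m - 1) 1 * gaussBinom q m 1 ^ (m - 1) +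
      gaussBinom q (m - 1) 1 ^ 2 * gaussBinom q (2 * m - 3) (m - 2) := by
  subst hq
  have hq2 : 1 < Fintype.card F := Fintype.one_lt_card
  have hint' : ∀ A ∈ ℱ, ∀ B ∈ ℱ, A ⊓ B ≠ ⊥ := fun A hA B hB =>
    Submodule.one_le_finrank_iff.1 (hint A hA B hB)
  have hcov : ∀ W : Submodule F V, finrank F W < m → ∃ A ∈ ℱ, W ⊓ A = ⊥ := by
    intro W hW
    by_contra! h
    exact Nat.notMem_of_lt_sInf (hW.trans_eq hτ.symm)
      ⟨W, rfl, fun A hA => Submodule.one_le_finrank_iff.2 (h A hA)⟩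
  have hg := gaussBinom_nonneg (Fintype.card F) (2 * m - 3) (m - 2) hq2
  set K := min ((∑ i ∈ Finset.range m, Fintype.card F ^ i) ^ (m - 2))
    ⌊gaussBinom (Fintype.card F) (2 * m - 3) (m - 2)⌋₊ with hKdef
  have : Finite (Submodule F V) := finite_submodule
  have h := ncard_le_of_two_mul_le_finrank_sSup (K := K) hdim hint' hcov hm hX
    (min_le_left _ _) fun L Y hL hY => by
      refine le_min ?_ (Nat.le_floor ?_)
      · exact (Set.ncard_le_ncard (t := {E ∈ ℱ | L ≤ E}) (fun E hE => ⟨hE.1, hE.2.1⟩)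
          (Set.toFinite _)).trans
          (ncard_above_le hdim hint' hcov L (by lia))
      · have h := ncard_submodule_Icc_le_gaussBinom L Y (m - 2)
        rw [hL, hY, show 2 * m - 1 - 2 = 2 * m - 3 by lia] at h
        refine (Nat.cast_le.2 (Set.ncard_le_ncard ?_ (Set.toFinite _))).trans h
        exact fun E hE => ⟨hE.2, (hdim E hE.1).trans (by lia)⟩
  have hK : (K : ℚ) ≤ gaussBinom (Fintype.card F) (2 * m - 3) (m - 2) :=
    (Nat.cast_le.2 (min_le_right _ _)).trans (Nat.floor_le hg)
  rw [gaussBinom_one_right _ _ hq2, gaussBinom_one_right _ _ hq2]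
  calc (ℱ.ncard : ℚ) ≤ _ := Nat.cast_le.2 h
    _ ≤ _ := by
      push_cast
      gcongr
end

section
/- Let q be a prime power with q ≥ m + 2 and m ≥ 3. Let n > 0 and l ≥ 0 be integers, V an (n+l)-dimensional vector space over 𝔽_q, and W₁ a fixed l-dimensional subspace of V. Let 0 ≤ k ≤ min{m, l}, m − k ≤ n, and let ℱ be an intersecting family of subspaces of type (m,k) with covering number τ(ℱ) = m. Then |ℱ| ≤ N(m,k;2m−1,t;n+l,n), where t = max{0, 2m−1−n} if k = 0 and t = m+k−1 if k ≥ 1; and equality holds if and only if there exists a subspace X of V of type (2m−1,t) such that ℱ is the family of all subspaces of type (m,k) contained in X. -/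
open Module

section Subspaces

variable {F V : Type*} [Field F] [AddCommGroup V] [Module F V] [FiniteDimensional F V]

theorem finrank_sup_span_singleton_of_notMem {S : Submodule F V} {v : V} (hv : v ∉ S) :
    finrank F ↥(S ⊔ F ∙ v) = finrank F S + 1 := by
  have hv0 : v ≠ 0 := fun h => hv (h ▸ S.zero_mem)
  have hd : Disjoint S (F ∙ v) := (Submodule.disjoint_span_singleton' hv0).2 hv
  have := Submodule.finrank_sup_add_finrank_inf_eq S (F ∙ v)
  rw [hd.eq_bot, finrank_bot, finrank_span_singleton hv0] at this
  simpa using this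

theorem exists_between_finrank_eq {A B : Submodule F V} (hAB : A ≤ B) {d : ℕ}
    (hA : finrank F A ≤ d) (hB : d ≤ finrank F B) :
    ∃ D : Submodule F V, A ≤ D ∧ D ≤ B ∧ finrank F D = d := by
  induction d, hA using Nat.le_induction with
  | base => exact ⟨A, le_rfl, hAB, rfl⟩
  | succ d _ ih =>
    obtain ⟨D, hAD, hDB, hD⟩ := ih (by omega)
    have hlt : D < B := lt_of_le_of_ne hDB (by rintro rfl; omega)
    obtain ⟨v, hvB, hvD⟩ := SetLike.exists_of_lt hlt
    refine ⟨D ⊔ F ∙ v, hAD.trans le_sup_left,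
      sup_le hDB ((Submodule.span_singleton_le_iff_mem v B).2 hvB), ?_⟩
    rw [finrank_sup_span_singleton_of_notMem hvD, hD]

/-- A subspace equipped with a smaller subspace embeds any other such pair with a smaller second
component. -/
theorem exists_linearEquiv_map_le {P X U U' : Submodule F V} (hU : U ≤ P) (hU' : U' ≤ X)
    (hPX : finrank F P = finrank F X) (h : finrank F U ≤ finrank F U') :
    ∃ g : V ≃ₗ[F] V, P.map (g : V →ₗ[F] V) = X ∧ U.map (g : V →ₗ[F] V) ≤ U' := by
  obtain ⟨D, -, hD, hDU⟩ := exists_between_finrank_eq (bot_le : ⊥ ≤ U')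
    (d := finrank F U) (by simp) h
  obtain ⟨g, hg⟩ := Submodule.exists_linearEquiv_restrict_eq (LinearEquiv.ofFinrankEq P X hPX)
  have hgP : P.map (g : V →ₗ[F] V) ≤ X := by
    rintro _ ⟨x, hx, rfl⟩
    simpa using (hg ⟨x, hx⟩) ▸ (LinearEquiv.ofFinrankEq P X hPX ⟨x, hx⟩).2
  have hgP' : P.map (g : V →ₗ[F] V) = X :=
    Submodule.eq_of_le_of_finrank_eq hgP (by rw [← hPX]; exact g.finrank_map_eq P)
  set U₁ := U.map (g : V →ₗ[F] V) with hU₁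
  have hU₁X : U₁ ≤ X := hgP' ▸ Submodule.map_mono hU
  have e : (U₁.submoduleOf X) ≃ₗ[F] (D.submoduleOf X) := by
    refine LinearEquiv.ofFinrankEq _ _ ?_
    rw [(Submodule.submoduleOfEquivOfLe hU₁X).finrank_eq,
      (Submodule.submoduleOfEquivOfLe (hD.trans hU')).finrank_eq, hDU]
    exact g.finrank_map_eq U
  obtain ⟨k, hk⟩ := Submodule.exists_linearEquiv_restrict_eq e
  obtain ⟨k', hk'⟩ := Submodule.exists_linearEquiv_restrict_eq k
  refine ⟨g.trans k', Submodule.eq_of_le_of_finrank_eq ?_ ?_, ?_⟩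
  · rintro _ ⟨x, hx, rfl⟩
    have hx' : g x ∈ X := hgP ⟨x, hx, rfl⟩
    have := hk' ⟨g x, hx'⟩
    simp only [LinearEquiv.coe_coe, LinearEquiv.trans_apply]
    rw [← this]
    exact (k _).2
  · rw [← hPX]; exact (g.trans k').finrank_map_eq P
  · rintro _ ⟨x, hx, rfl⟩
    have hxU : g x ∈ U₁ := ⟨x, hx, rfl⟩
    have h1 := hk' ⟨g x, hU₁X hxU⟩
    have h2 := hk ⟨⟨g x, hU₁X hxU⟩, hxU⟩
    simp only [LinearEquiv.coe_coe, LinearEquiv.trans_apply]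
    rw [← h1, ← h2]
    exact hD (e _).2

theorem exists_le_ncard_subspaces_of_type_eq {P X W : Submodule F V} (m k : ℕ)
    (hPX : finrank F P = finrank F X) (h : finrank F ↥(P ⊓ W) ≤ finrank F ↥(X ⊓ W)) :
    ∃ U ≤ X ⊓ W, finrank F U = finrank F ↥(P ⊓ W) ∧
      {S : Submodule F V | S ≤ P ∧ finrank F S = m ∧ finrank F ↥(S ⊓ W) = k}.ncard =
        {S : Submodule F V | S ≤ X ∧ finrank F S = m ∧ finrank F ↥(S ⊓ U) = k}.ncard := by
  obtain ⟨g, hgP, hgU⟩ := exists_linearEquiv_map_le inf_le_left inf_le_left hPX h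
  refine ⟨_, hgU, g.finrank_map_eq _, ?_⟩
  rw [← Set.ncard_image_of_injective _ (Submodule.map_injective_of_injective (f := g.toLinearMap)
    g.injective)]
  have key : ∀ S ≤ P, finrank F ↥(S.map g.toLinearMap ⊓ (P ⊓ W).map g.toLinearMap) =
      finrank F ↥(S ⊓ W) := by
    intro S hS
    rw [← Submodule.map_inf _ g.injective, ← inf_assoc, inf_eq_left.2 hS]
    exact g.finrank_map_eq _
  congr 1
  ext S
  constructor
  · rintro ⟨T, ⟨hTP, hT, hTW⟩, rfl⟩
    exact ⟨hgP ▸ Submodule.map_mono hTP, (g.finrank_map_eq T).trans hT, (key T hTP).trans hTW⟩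
  · rintro ⟨hSX, hS, hSU⟩
    have hS' : (S.comap g.toLinearMap).map g.toLinearMap = S :=
      Submodule.map_comap_eq_of_surjective g.surjective S
    have hle : S.comap g.toLinearMap ≤ P := by
      rw [← Submodule.map_le_map_iff_of_injective (f := g.toLinearMap) g.injective, hS']
      exact hSX.trans_eq hgP.symm
    refine ⟨S.comap g.toLinearMap, ⟨hle, ?_, ?_⟩, hS'⟩
    · have h1 : finrank F ↥((S.comap g.toLinearMap).map g.toLinearMap) =
          finrank F ↥(S.comap g.toLinearMap) := g.finrank_map_eq _
      rw [← h1, hS', hS]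
    · rw [← key _ hle, hS']
      exact hSU

theorem ncard_subspaces_of_type_eq {P X W : Submodule F V} (m k : ℕ)
    (hPX : finrank F P = finrank F X) (h : finrank F ↥(P ⊓ W) = finrank F ↥(X ⊓ W)) :
    {S : Submodule F V | S ≤ P ∧ finrank F S = m ∧ finrank F ↥(S ⊓ W) = k}.ncard =
      {S : Submodule F V | S ≤ X ∧ finrank F S = m ∧ finrank F ↥(S ⊓ W) = k}.ncard := by
  obtain ⟨U, hU, hUfin, hcard⟩ := exists_le_ncard_subspaces_of_type_eq m k hPX h.le
  have hUX : U = X ⊓ W := Submodule.eq_of_le_of_finrank_eq hU (hUfin.trans h)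
  rw [hcard]
  congr 1
  ext S
  refine and_congr_right fun hSX => ?_
  rw [hUX, ← inf_assoc, inf_eq_left.2 hSX]

end Subspaces

section Counting

variable {F V : Type*} [Field F] [Fintype F] [AddCommGroup V] [Module F V] [FiniteDimensional F V]

/-- Double counting of the incidences between members of `𝒜` and nonzero vectors of `A`. -/
theorem ncard_mul_le_of_forall_inf_ne_bot (𝒜 : Set (Submodule F V)) (A : Submodule F V) (B : ℕ)
    (h : ∀ S ∈ 𝒜, S ⊓ A ≠ ⊥) (hB : ∀ v ∈ A, v ≠ 0 → {S ∈ 𝒜 | v ∈ S}.ncard ≤ B) :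
    𝒜.ncard * (Fintype.card F - 1) ≤ (Fintype.card F ^ finrank F A - 1) * B := by
  classical
  have : Finite V := Module.finite_of_finite F
  have : Fintype V := Fintype.ofFinite V
  have hfin : 𝒜.Finite := Set.toFinite _
  set D : Finset V := Finset.univ.filter (fun v => v ∈ A ∧ v ≠ 0) with hD
  have hDcard : D.card = Fintype.card F ^ finrank F A - 1 := by
    have h1 : D = (Finset.univ.filter (fun v => v ∈ A)).erase 0 := by
      ext v; simp [hD, and_comm]
    rw [h1, Finset.card_erase_of_mem (by simp), ← Fintype.card_subtype]
    congr 1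
    exact Module.card_eq_pow_finrank (K := F) (V := A)
  rw [Set.ncard_eq_toFinset_card _ hfin, ← hDcard]
  refine Finset.card_mul_le_card_mul (fun (S : Submodule F V) (v : V) => v ∈ S) ?_ ?_
  · intro S hS
    obtain ⟨v, hv, hv0⟩ := Submodule.exists_mem_ne_zero_of_ne_bot (h S (by simpa using hS))
    have : (Finset.univ.filter (fun c : F => c ≠ 0)).card = Fintype.card F - 1 := by
      rw [Finset.filter_ne', Finset.card_erase_of_mem (Finset.mem_univ _), Finset.card_univ]
    rw [← this]
    refine Finset.card_le_card_of_injOn (fun c => c • v) ?_ ?_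
    · intro c hc
      have hc : c ≠ 0 := by simpa using hc
      simp [hD, hc, hv0, S.smul_mem c hv.1, A.smul_mem c hv.2]
    · intro c _ d _ hcd
      exact smul_left_injective F hv0 hcd
  · intro v hv
    have hv : v ∈ A ∧ v ≠ 0 := by simpa [hD] using hv
    refine le_trans (le_of_eq ?_) (hB v hv.1 hv.2)
    rw [← Set.ncard_coe_finset]
    congr 1
    ext S
    simp

theorem pow_mul_pred_le_ncard_complements {P U : Submodule F V} {m : ℕ} (hUP : U ≤ P)
    (hP : finrank F P = 2 * m - 1) (hU : finrank F U = m - 1) (hm : 1 ≤ m) :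
    Fintype.card F ^ (m * (m - 1)) ≤
      {S : Submodule F V | S ≤ P ∧ finrank F S = m ∧ S ⊓ U = ⊥}.ncard := by
  have : Finite V := Module.finite_of_finite F
  obtain ⟨C', hC'⟩ := Submodule.exists_isCompl U
  set C := C' ⊓ P with hC
  have hCP : C ≤ P := inf_le_right
  have hdisj : C ⊓ U = ⊥ := by
    rw [eq_bot_iff, ← hC'.inf_eq_bot]
    exact le_inf inf_le_right (inf_le_left.trans inf_le_left)
  have hsup : U ⊔ C = P := by
    rw [hC, ← sup_inf_assoc_of_le _ hUP, hC'.sup_eq_top, top_inf_eq]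
  have hCdim : finrank F C = m := by
    have := Submodule.finrank_sup_add_finrank_inf_eq C U
    rw [hdisj, sup_comm, hsup, finrank_bot] at this
    omega
  have hmem : ∀ (c : C) (u : U), (c : V) + u = 0 → c = 0 := by
    intro c u h
    have : (c : V) ∈ C ⊓ U := ⟨c.2, by rw [eq_neg_of_add_eq_zero_left h]; exact U.neg_mem u.2⟩
    rw [hdisj] at this
    simpa using this
  let φ : (C →ₗ[F] U) → (C →ₗ[F] V) := fun f => C.subtype + U.subtype ∘ₗ f
  have hφ : ∀ f c, φ f c = c + f c := fun f c => rfl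
  have hcard : Nat.card (C →ₗ[F] U) = Fintype.card F ^ (m * (m - 1)) := by
    rw [Module.natCard_eq_pow_finrank (K := F), Module.finrank_linearMap, hCdim, hU,
      Nat.card_eq_fintype_card]
  rw [← hcard, ← Set.ncard_univ]
  refine Set.ncard_le_ncard_of_injOn (fun f => LinearMap.range (φ f)) ?_ ?_ (Set.toFinite _)
  · intro f _
    refine ⟨?_, ?_, ?_⟩
    · rintro _ ⟨c, rfl⟩
      exact P.add_mem (hCP c.2) (hUP (f c).2)
    · rw [LinearMap.finrank_range_of_inj, hCdim]
      rw [← LinearMap.ker_eq_bot, LinearMap.ker_eq_bot']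
      exact fun c hc => hmem c _ hc
    · rw [eq_bot_iff]
      rintro _ ⟨⟨c, rfl⟩, hu⟩
      have : c = 0 := by
        refine hmem c ⟨-(c : V), ?_⟩ (by simp)
        rw [hφ] at hu
        exact U.neg_mem ((Submodule.add_mem_iff_left U (f c).2).1 hu)
      simp [this]
  · intro f _ g _ hfg
    ext c
    have : φ f c ∈ LinearMap.range (φ g) := by
      have hfg : LinearMap.range (φ f) = LinearMap.range (φ g) := hfg
      rw [← hfg]; exact ⟨c, rfl⟩
    obtain ⟨d, hd⟩ := this
    rw [hφ, hφ] at hd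
    have hdc : d - c = 0 := hmem (d - c) (g d - f c) (by
      push_cast
      rw [sub_add_sub_comm, hd, sub_self])
    rw [sub_eq_zero] at hdc
    subst hdc
    exact (add_left_cancel hd).symm


theorem ncard_mul_mul_le_of_forall_inf_ne_bot (𝒜 : Set (Submodule F V)) (A : Submodule F V)
    {w B : ℕ} (hw : 0 < w) (h : ∀ S ∈ 𝒜, S ⊓ A ≠ ⊥)
    (hB : ∀ v ∈ A, v ≠ 0 → {S ∈ 𝒜 | v ∈ S}.ncard * w ≤ B) :
    𝒜.ncard * ((Fintype.card F - 1) * w) ≤ (Fintype.card F ^ finrank F A - 1) * B := by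
  have := ncard_mul_le_of_forall_inf_ne_bot 𝒜 A (B / w) h
    fun v hv hv0 => (Nat.le_div_iff_mul_le hw).2 (hB v hv hv0)
  calc 𝒜.ncard * ((Fintype.card F - 1) * w) = 𝒜.ncard * (Fintype.card F - 1) * w := by ring
    _ ≤ (Fintype.card F ^ finrank F A - 1) * (B / w) * w := Nat.mul_le_mul_right _ this
    _ = (Fintype.card F ^ finrank F A - 1) * (B / w * w) := by ring
    _ ≤ _ := Nat.mul_le_mul_left _ (Nat.div_mul_le_self _ _)

theorem mul_pow_lt_of_add_two_le {q m : ℕ} (hm : 2 ≤ m) (hq : m + 2 ≤ q) :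
    2 * (q ^ (m - 1) - 1) * (q ^ m - 1) ^ (m - 1) < q ^ (m * (m - 1)) * (q - 1) ^ m := by
  have hbern : ∀ j : ℕ, (q : ℤ) ^ j * (q - j) ≤ q * (q - 1) ^ j := by
    intro j
    induction j with
    | zero => simp
    | succ j ih =>
      have hq1 : (0 : ℤ) ≤ q - 1 := by omega
      have h1 := mul_le_mul_of_nonneg_left ih hq1
      have h2 : (0 : ℤ) ≤ (q : ℤ) ^ j * j := by positivity
      push_cast
      rw [pow_succ, pow_succ]
      nlinarith
  have h1 : 2 * q ^ (m - 1) ≤ (q - 1) ^ m := by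
    have hb := hbern m
    have h2 : (q : ℤ) ^ m * 2 ≤ (q : ℤ) ^ m * (q - m) :=
      mul_le_mul_of_nonneg_left (by omega) (by positivity)
    have h3 : q * (2 * q ^ (m - 1)) ≤ q * (q - 1) ^ m := by
      have h4 : q ^ m = q * q ^ (m - 1) := by
        rw [← pow_succ', Nat.sub_add_cancel (by omega)]
      have h5 : q ^ m * 2 ≤ q * (q - 1) ^ m := by
        zify [show 1 ≤ q by omega]
        exact h2.trans hb
      rw [h4] at h5
      linarith
    exact Nat.le_of_mul_le_mul_left h3 (by omega)
  have hq0 : 0 < q := by omega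
  have hp1 : 0 < q ^ (m - 1) := by positivity
  have h6 : 2 * (q ^ (m - 1) - 1) < 2 * q ^ (m - 1) := by omega
  calc 2 * (q ^ (m - 1) - 1) * (q ^ m - 1) ^ (m - 1)
      ≤ 2 * (q ^ (m - 1) - 1) * (q ^ m) ^ (m - 1) := by gcongr; omega
    _ < 2 * q ^ (m - 1) * (q ^ m) ^ (m - 1) := Nat.mul_lt_mul_of_pos_right h6 (by positivity)
    _ ≤ (q - 1) ^ m * (q ^ m) ^ (m - 1) := Nat.mul_le_mul_right _ h1
    _ = _ := by rw [← pow_mul, mul_comm]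

end Counting

section IntersectingFamily

variable {F V : Type*} [Field F] [Fintype F] [AddCommGroup V] [Module F V] [FiniteDimensional F V]
  {ℱ : Set (Submodule F V)} {m : ℕ}

theorem ncard_ge_mul_pow_le (hdim : ∀ A ∈ ℱ, finrank F A = m)
    (hint : ∀ A ∈ ℱ, ∀ B ∈ ℱ, A ⊓ B ≠ ⊥)
    (hcov : ∀ S : Submodule F V, finrank F S < m → ∃ A ∈ ℱ, A ⊓ S = ⊥) {c : ℕ}
    (hc : ∀ T : Submodule F V, finrank F T = m - 1 →
      {S ∈ ℱ | T ≤ S}.ncard * (Fintype.card F - 1) ≤ c) (j : ℕ) :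
    ∀ S : Submodule F V, finrank F S + (j + 1) = m →
      {A ∈ ℱ | S ≤ A}.ncard * (Fintype.card F - 1) ^ (j + 1) ≤
        (Fintype.card F ^ m - 1) ^ j * c := by
  have hq := Fintype.one_lt_card (α := F)
  induction j with
  | zero => intro S hS; simpa using hc S (by omega)
  | succ j ih =>
    intro S hS
    obtain ⟨A, hA, hAS⟩ := hcov S (by omega)
    have := ncard_mul_mul_le_of_forall_inf_ne_bot {B ∈ ℱ | S ≤ B} A
      (w := (Fintype.card F - 1) ^ (j + 1)) (pow_pos (by omega) _)
      (fun B hB => hint B hB.1 A hA) (B := (Fintype.card F ^ m - 1) ^ j * c) ?_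
    · rw [hdim A hA] at this
      rw [pow_succ' _ (j + 1), pow_succ' (Fintype.card F ^ m - 1) j, mul_assoc _ _ c]
      exact this
    · intro v hv hv0
      have hvS : v ∉ S := fun h => hv0 (by
        have : v ∈ A ⊓ S := ⟨hv, h⟩
        simpa [hAS] using this)
      have h1 := ih (S ⊔ F ∙ v) (by rw [finrank_sup_span_singleton_of_notMem hvS]; omega)
      convert h1 using 4
      ext B
      simp [and_assoc]

theorem ncard_le_of_unique_above (hdim : ∀ A ∈ ℱ, finrank F A = m) {T A : Submodule F V}
    (hT : finrank F T + 1 = m) (hTA : A ⊓ T = ⊥) (hA : ∀ B ∈ ℱ, T ≤ B → B ⊓ A ≠ ⊥) :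
    {B ∈ ℱ | T ≤ B}.ncard * (Fintype.card F - 1) ≤ Fintype.card F ^ finrank F A - 1 := by
  have := ncard_mul_le_of_forall_inf_ne_bot {B ∈ ℱ | T ≤ B} A 1 (fun B hB => hA B hB.1 hB.2) ?_
  · simpa using this
  · intro v hv hv0
    have hvT : v ∉ T := fun h => hv0 (by
      have : v ∈ A ⊓ T := ⟨hv, h⟩
      simpa [hTA] using this)
    refine (Set.ncard_le_ncard (t := {T ⊔ F ∙ v}) ?_ (Set.toFinite _)).trans
      (Set.ncard_singleton _).le
    rintro B ⟨⟨hB, hTB⟩, hvB⟩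
    refine (Submodule.eq_of_le_of_finrank_eq
      (sup_le hTB ((Submodule.span_singleton_le_iff_mem v B).2 hvB)) ?_).symm
    rw [finrank_sup_span_singleton_of_notMem hvT, hdim B hB, hT]

theorem ncard_meeting_mul_pow_le (hm : 2 ≤ m) (hdim : ∀ A ∈ ℱ, finrank F A = m)
    (hint : ∀ A ∈ ℱ, ∀ B ∈ ℱ, A ⊓ B ≠ ⊥)
    (hcov : ∀ S : Submodule F V, finrank F S < m → ∃ A ∈ ℱ, A ⊓ S = ⊥) {E : Submodule F V}
    (hE : finrank F E ≤ m - 1) :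
    {A ∈ ℱ | A ⊓ E ≠ ⊥}.ncard * (Fintype.card F - 1) ^ m ≤
      (Fintype.card F ^ (m - 1) - 1) * (Fintype.card F ^ m - 1) ^ (m - 1) := by
  have : Finite (Submodule F V) := finite_submodule
  have hq := Fintype.one_lt_card (α := F)
  have hline := ncard_ge_mul_pow_le hdim hint hcov (c := Fintype.card F ^ m - 1) (fun T hT => by
    obtain ⟨A, hA, hAT⟩ := hcov T (by omega)
    rw [← hdim A hA]
    exact ncard_le_of_unique_above hdim (by omega) hAT fun B hB _ => hint B hB A hA) (m - 2)
  have := ncard_mul_mul_le_of_forall_inf_ne_bot {A ∈ ℱ | A ⊓ E ≠ ⊥} E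
    (w := (Fintype.card F - 1) ^ (m - 1)) (pow_pos (by omega) _)
    (fun B hB => hB.2) (B := (Fintype.card F ^ m - 1) ^ (m - 1)) ?_
  · rw [← pow_succ', Nat.sub_add_cancel (by omega)] at this
    refine this.trans (Nat.mul_le_mul_right _ (Nat.sub_le_sub_right ?_ 1))
    exact Nat.pow_le_pow_right (by omega) hE
  · intro v _ hv0
    have h1 := hline (F ∙ v) (by rw [finrank_span_singleton hv0]; omega)
    rw [← pow_succ, show m - 2 + 1 = m - 1 by omega] at h1
    refine le_trans (Nat.mul_le_mul_right _ (Set.ncard_le_ncard ?_ (Set.toFinite _))) h1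
    rintro B ⟨⟨hB, _⟩, hvB⟩
    exact ⟨hB, (Submodule.span_singleton_le_iff_mem v B).2 hvB⟩

/-- An intersecting family that no `(m - 1)`-dimensional subspace covers and that is not confined to
a `(2 * m - 1)`-dimensional subspace is small. -/
theorem ncard_mul_pow_le_of_not_subset (hm : 2 ≤ m) (hdim : ∀ A ∈ ℱ, finrank F A = m)
    (hint : ∀ A ∈ ℱ, ∀ B ∈ ℱ, A ⊓ B ≠ ⊥)
    (hcov : ∀ S : Submodule F V, finrank F S < m → ∃ A ∈ ℱ, A ⊓ S = ⊥)
    (hX : ∀ X : Submodule F V, finrank F X = 2 * m - 1 → ∃ A ∈ ℱ, ¬ A ≤ X) :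
    ℱ.ncard * (Fintype.card F - 1) ^ m ≤
      2 * (Fintype.card F ^ (m - 1) - 1) * (Fintype.card F ^ m - 1) ^ (m - 1) := by
  have : Finite (Submodule F V) := finite_submodule
  have hq := Fintype.one_lt_card (α := F)
  by_cases hT : ∀ T : Submodule F V, finrank F T = m - 1 →
      {S ∈ ℱ | T ≤ S}.ncard * (Fintype.card F - 1) ≤ Fintype.card F ^ (m - 1) - 1
  · have := ncard_ge_mul_pow_le hdim hint hcov hT (m - 1) ⊥ (by rw [finrank_bot]; omega)
    rw [Nat.sub_add_cancel (by omega)] at this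
    simp only [bot_le, and_true, Set.ofPred_mem_eq] at this
    rw [mul_assoc, mul_comm (Fintype.card F ^ (m - 1) - 1)]
    exact this.trans (Nat.le_mul_of_pos_left _ two_pos)
  push Not at hT
  obtain ⟨T, hTm, hTn⟩ := hT
  obtain ⟨A₀, hA₀, hA₀T⟩ := hcov T (by omega)
  have hspan : ∀ A ∈ ℱ, A ⊓ T = ⊥ → finrank F ↥(A ⊔ T) = 2 * m - 1 := by
    intro A hA hAT
    have := Submodule.finrank_sup_add_finrank_inf_eq A T
    rw [hAT, finrank_bot, hdim A hA] at this
    omega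
  have hmiss : ∀ A ∈ ℱ, A ⊓ T = ⊥ → A ≤ A₀ ⊔ T := by
    intro A hA hAT
    by_contra hnot
    have hlt : finrank F ↥(A₀ ⊓ (A ⊔ T)) < m := by
      rw [← hdim A₀ hA₀]
      refine Submodule.finrank_lt_finrank_of_lt (lt_of_le_of_ne inf_le_left fun h => hnot ?_)
      have hle : A₀ ⊔ T ≤ A ⊔ T := sup_le (inf_eq_left.1 h) le_sup_right
      rw [Submodule.eq_of_le_of_finrank_eq hle
        ((hspan A₀ hA₀ hA₀T).trans (hspan A hA hAT).symm)]
      exact le_sup_left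
    have hbound := ncard_le_of_unique_above hdim (T := T) (A := A₀ ⊓ (A ⊔ T)) (by omega)
      (by rw [inf_right_comm, hA₀T, bot_inf_eq]) ?_
    · have : Fintype.card F ^ finrank F ↥(A₀ ⊓ (A ⊔ T)) ≤ Fintype.card F ^ (m - 1) :=
        Nat.pow_le_pow_right (by omega) (by omega)
      omega
    · intro B hB hTB
      obtain ⟨v, hv, hv0⟩ := Submodule.exists_mem_ne_zero_of_ne_bot (hint B hB A hA)
      have hvT : v ∉ T := fun h => hv0 (by
        have : v ∈ A ⊓ T := ⟨hv.2, h⟩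
        simpa [hAT] using this)
      have hBv : T ⊔ F ∙ v = B := Submodule.eq_of_le_of_finrank_eq
        (sup_le hTB ((Submodule.span_singleton_le_iff_mem v B).2 hv.1))
        (by rw [finrank_sup_span_singleton_of_notMem hvT, hdim B hB]; omega)
      have hBle : B ≤ A ⊔ T := hBv ▸ sup_le le_sup_right
        ((Submodule.span_singleton_le_iff_mem v _).2 (Submodule.mem_sup_left hv.2))
      rw [inf_left_comm, inf_eq_left.2 hBle, inf_comm]
      exact hint B hB A₀ hA₀
  obtain ⟨C, hC, hCX⟩ := hX (A₀ ⊔ T) (hspan A₀ hA₀ hA₀T)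
  have hE : finrank F ↥(C ⊓ (A₀ ⊔ T)) ≤ m - 1 := by
    have : finrank F ↥(C ⊓ (A₀ ⊔ T)) < finrank F C := Submodule.finrank_lt_finrank_of_lt
      (lt_of_le_of_ne inf_le_left fun h => hCX (inf_eq_left.1 h))
    rw [hdim C hC] at this
    omega
  have h1 := ncard_meeting_mul_pow_le hm hdim hint hcov hTm.le
  have h2 := ncard_meeting_mul_pow_le hm hdim hint hcov hE
  have hsub : ℱ ⊆ {A ∈ ℱ | A ⊓ T ≠ ⊥} ∪ {A ∈ ℱ | A ⊓ (C ⊓ (A₀ ⊔ T)) ≠ ⊥} := by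
    intro A hA
    by_cases hAT : A ⊓ T = ⊥
    · refine Or.inr ⟨hA, ?_⟩
      rw [inf_left_comm, inf_eq_left.2 (hmiss A hA hAT)]
      exact hint C hC A hA
    · exact Or.inl ⟨hA, hAT⟩
  have h3 := (Set.ncard_le_ncard hsub (Set.toFinite _)).trans (Set.ncard_union_le _ _)
  have h4 := Nat.mul_le_mul_right ((Fintype.card F - 1) ^ m) h3
  rw [add_mul] at h4
  linarith

end IntersectingFamily

section Types

variable {F V : Type*} [Field F] [Fintype F] [AddCommGroup V] [Module F V] [FiniteDimensional F V]

theorem ncard_subspaces_of_type_zero_lt {P X W : Submodule F V} {m : ℕ} (hm : 1 ≤ m)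
    (hPX : finrank F P = finrank F X) (h : finrank F ↥(P ⊓ W) < finrank F ↥(X ⊓ W))
    (hmP : m + finrank F ↥(P ⊓ W) ≤ finrank F P) :
    {S : Submodule F V | S ≤ X ∧ finrank F S = m ∧ finrank F ↥(S ⊓ W) = 0}.ncard <
      {S : Submodule F V | S ≤ P ∧ finrank F S = m ∧ finrank F ↥(S ⊓ W) = 0}.ncard := by
  have : Finite (Submodule F V) := finite_submodule
  obtain ⟨U, hU, hUfin, hcard⟩ := exists_le_ncard_subspaces_of_type_eq m 0 hPX h.le
  rw [hcard]
  have hlt : U < X ⊓ W := lt_of_le_of_ne hU (by rintro rfl; omega)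
  obtain ⟨v, hv, hvU⟩ := SetLike.exists_of_lt hlt
  have hv0 : v ≠ 0 := fun h => hvU (h ▸ U.zero_mem)
  have hvX : F ∙ v ≤ X := (Submodule.span_singleton_le_iff_mem v X).2 hv.1
  have hdisj : Disjoint U (F ∙ v) := (Submodule.disjoint_span_singleton' hv0).2 hvU
  obtain ⟨C, hvC, hC⟩ := hdisj.symm.exists_isCompl
  have hCX : finrank F X ≤ finrank F ↥(C ⊓ X) + finrank F U := by
    have h1 : U ⊔ C ⊓ X = X := by
      rw [← sup_inf_assoc_of_le _ (hU.trans inf_le_left), hC.symm.sup_eq_top, top_inf_eq]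
    have h2 := Submodule.finrank_add_le_finrank_add_finrank U (C ⊓ X)
    rw [h1] at h2
    omega
  obtain ⟨D, hvD, hDC, hD⟩ := exists_between_finrank_eq (le_inf hvC hvX)
    (d := m) (by rw [finrank_span_singleton hv0]; exact hm) (by omega)
  have hvD' : v ∈ D := hvD (Submodule.mem_span_singleton_self v)
  refine Set.ncard_lt_ncard ⟨?_, fun hsub => ?_⟩ (Set.toFinite _)
  · rintro S ⟨hSX, hS, hSW⟩
    refine ⟨hSX, hS, Nat.le_zero.1 (hSW ▸ Submodule.finrank_mono ?_)⟩
    exact inf_le_inf_left S (hU.trans inf_le_right)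
  · have hDU : D ⊓ U = ⊥ := by
      rw [eq_bot_iff, ← hC.inf_eq_bot]
      exact inf_le_inf_right U (hDC.trans inf_le_left)
    have hDW := (hsub ⟨hDC.trans inf_le_right, hD, by rw [hDU, finrank_bot]⟩).2.2
    rw [Submodule.finrank_eq_zero] at hDW
    have : v ∈ D ⊓ W := ⟨hvD', hv.2⟩
    rw [hDW] at this
    exact hv0 (by simpa using this)

theorem pow_le_ncard_subspaces_of_type {P W : Submodule F V} {m k : ℕ} (hm : 1 ≤ m)
    (hP : finrank F P = 2 * m - 1)
    (h : k = 0 ∧ finrank F ↥(P ⊓ W) ≤ m - 1 ∨ finrank F ↥(P ⊓ W) = m + k - 1) :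
    Fintype.card F ^ (m * (m - 1)) ≤
      {S : Submodule F V | S ≤ P ∧ finrank F S = m ∧ finrank F ↥(S ⊓ W) = k}.ncard := by
  have : Finite (Submodule F V) := finite_submodule
  rcases h with ⟨rfl, h⟩ | h
  · obtain ⟨U, hWU, hUP, hU⟩ := exists_between_finrank_eq (inf_le_left : P ⊓ W ≤ P) h (by omega)
    refine (pow_mul_pred_le_ncard_complements hUP hP hU hm).trans
      (Set.ncard_le_ncard ?_ (Set.toFinite _))
    rintro S ⟨hSP, hS, hSU⟩
    refine ⟨hSP, hS, ?_⟩
    rw [Submodule.finrank_eq_zero, eq_bot_iff, ← hSU]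
    exact le_inf inf_le_left ((inf_le_inf_right W hSP).trans hWU)
  · obtain ⟨U, -, hUW, hU⟩ := exists_between_finrank_eq (bot_le : ⊥ ≤ P ⊓ W)
      (d := m - 1) (by simp) (by omega)
    have hUP := hUW.trans inf_le_left
    refine (pow_mul_pred_le_ncard_complements hUP hP hU hm).trans
      (Set.ncard_le_ncard ?_ (Set.toFinite _))
    rintro S ⟨hSP, hS, hSU⟩
    refine ⟨hSP, hS, ?_⟩
    have h1 := Submodule.finrank_sup_add_finrank_inf_eq S U
    have h2 := Submodule.finrank_sup_add_finrank_inf_eq S (P ⊓ W)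
    have h3 := Submodule.finrank_mono (sup_le_sup_left hUW S)
    have h4 := Submodule.finrank_mono (sup_le hSP (inf_le_left : P ⊓ W ≤ P))
    rw [hSU, finrank_bot] at h1
    rw [← inf_assoc, inf_eq_left.2 hSP] at h2
    omega

end Types

theorem stmt19 {F V : Type*} [Field F] [Fintype F] [AddCommGroup V] [Module F V]
    [FiniteDimensional F V] {q n l m k t : ℕ} (hq : Fintype.card F = q)
    (hqm : m + 2 ≤ q) (hm : 3 ≤ m)
    (hn : 0 < n) (hV : finrank F V = n + l)
    (W₁ : Submodule F V) (hW₁ : finrank F ↥W₁ = l)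
    (hk : k ≤ min m l) (hmk : m - k ≤ n)
    (ℱ : Set (Submodule F V))
    (hmem : ∀ A ∈ ℱ, finrank F ↥A = m ∧ finrank F ↥(A ⊓ W₁) = k)
    (hint : IsIntersectingFamily ℱ) (hτ : coveringNumber ℱ = m)
    (ht : t = if k = 0 then 2 * m - 1 - n else m + k - 1) :
    ∀ P : Submodule F V, finrank F ↥P = 2 * m - 1 → finrank F ↥(P ⊓ W₁) = t →
      ℱ.ncard ≤ {S : Submodule F V | S ≤ P ∧ finrank F ↥S = m ∧
          finrank F ↥(S ⊓ W₁) = k}.ncard ∧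
        (ℱ.ncard = {S : Submodule F V | S ≤ P ∧ finrank F ↥S = m ∧
            finrank F ↥(S ⊓ W₁) = k}.ncard ↔
          ∃ X : Submodule F V, finrank F ↥X = 2 * m - 1 ∧ finrank F ↥(X ⊓ W₁) = t ∧
            ℱ = {S : Submodule F V | S ≤ X ∧ finrank F ↥S = m ∧
              finrank F ↥(S ⊓ W₁) = k}) := by
  subst hq
  intro P hP hPt
  have : Finite (Submodule F V) := finite_submodule
  have hint' : ∀ A ∈ ℱ, ∀ B ∈ ℱ, A ⊓ B ≠ ⊥ := fun A hA B hB =>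
    Submodule.one_le_finrank_iff.1 (hint A hA B hB)
  have hdim : ∀ A ∈ ℱ, finrank F A = m := fun A hA => (hmem A hA).1
  have hcov : ∀ S : Submodule F V, finrank F S < m → ∃ A ∈ ℱ, A ⊓ S = ⊥ := by
    intro S hS
    by_contra! hno
    have hle : ¬ coveringNumber ℱ ≤ finrank F S := by omega
    refine hle (Nat.sInf_le ⟨S, rfl, fun A hA => ?_⟩)
    rw [Submodule.one_le_finrank_iff, inf_comm]
    exact hno A hA
  have htype : k = 0 ∧ t ≤ m - 1 ∨ t = m + k - 1 := by
    split_ifs at ht with hk0 <;> omega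
  have hinfW : ∀ Y : Submodule F V, finrank F Y ≤ n + finrank F ↥(Y ⊓ W₁) := by
    intro Y
    have h1 := Submodule.finrank_sup_add_finrank_inf_eq Y W₁
    have h2 := Submodule.finrank_le (Y ⊔ W₁)
    omega
  have hRL : ∀ X : Submodule F V, finrank F X = 2 * m - 1 → finrank F ↥(X ⊓ W₁) = t →
      ({S : Submodule F V | S ≤ P ∧ finrank F S = m ∧ finrank F ↥(S ⊓ W₁) = k}.ncard =
        {S : Submodule F V | S ≤ X ∧ finrank F S = m ∧ finrank F ↥(S ⊓ W₁) = k}.ncard) :=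
    fun X hX hXt => ncard_subspaces_of_type_eq m k (hP.trans hX.symm) (hPt.trans hXt.symm)
  by_cases hX : ∀ X : Submodule F V, finrank F X = 2 * m - 1 → ∃ A ∈ ℱ, ¬ A ≤ X
  · have hlt : ℱ.ncard <
        {S : Submodule F V | S ≤ P ∧ finrank F S = m ∧ finrank F ↥(S ⊓ W₁) = k}.ncard := by
      refine lt_of_lt_of_le (Nat.lt_of_mul_lt_mul_right
        ((ncard_mul_pow_le_of_not_subset (by omega) hdim hint' hcov hX).trans_lt
          (mul_pow_lt_of_add_two_le (by omega) hqm)))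
        (pow_le_ncard_subspaces_of_type (by omega) hP (hPt ▸ htype))
    refine ⟨hlt.le, fun h => absurd h hlt.ne, ?_⟩
    rintro ⟨X, hXm, -, hℱ⟩
    obtain ⟨A, hA, hAX⟩ := hX X hXm
    rw [hℱ] at hA
    exact absurd hA.1 hAX
  · push Not at hX
    obtain ⟨X, hXm, hℱX⟩ := hX
    have hsub : ℱ ⊆ {S : Submodule F V | S ≤ X ∧ finrank F S = m ∧
        finrank F ↥(S ⊓ W₁) = k} := fun A hA => ⟨hℱX A hA, hmem A hA⟩
    have hle := Set.ncard_le_ncard hsub (Set.toFinite _)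
    suffices h : finrank F ↥(X ⊓ W₁) = t ∨
        {S : Submodule F V | S ≤ X ∧ finrank F S = m ∧ finrank F ↥(S ⊓ W₁) = k}.ncard <
          {S : Submodule F V | S ≤ P ∧ finrank F S = m ∧ finrank F ↥(S ⊓ W₁) = k}.ncard by
      refine ⟨?_, fun heq => ?_, ?_⟩
      · rcases h with h | h
        · exact hle.trans_eq (hRL X hXm h).symm
        · exact hle.trans h.le
      · rcases h with h | h
        · exact ⟨X, hXm, h, Set.eq_of_subset_of_ncard_le hsub
            (by rw [heq, hRL X hXm h]) (Set.toFinite _)⟩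
        · omega
      · rintro ⟨Y, hY, hYt, hℱ⟩
        rw [hRL Y hY hYt, ← hℱ]
    obtain ⟨A, hA, -⟩ := hcov ⊥ (by rw [finrank_bot]; omega)
    have hAX : finrank F ↥(X ⊓ W₁) + 1 ≤ m + k := by
      have h1 := Submodule.finrank_sup_add_finrank_inf_eq A (X ⊓ W₁)
      have h2 := Submodule.finrank_mono (sup_le (hℱX A hA) (inf_le_left : X ⊓ W₁ ≤ X))
      rw [← inf_assoc, inf_eq_left.2 (hℱX A hA), (hmem A hA).1, (hmem A hA).2] at h1
      omega
    rcases Nat.eq_zero_or_pos k with rfl | hkpos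
    · refine (eq_or_ne (finrank F ↥(X ⊓ W₁)) t).imp_right fun hne => ?_
      have h1 := hinfW X
      rw [if_pos rfl] at ht
      exact ncard_subspaces_of_type_zero_lt (by omega) (hP.trans hXm.symm) (by omega) (by omega)
    · left
      rw [if_neg (by omega)] at ht
      by_contra hne
      obtain ⟨E, -, hEX, hE⟩ := exists_between_finrank_eq (bot_le : ⊥ ≤ X ⊓ W₁)
        (d := finrank F ↥(X ⊓ W₁) + 1 - k) (by simp) (by omega)
      obtain ⟨B, hB, hBE⟩ := hcov E (by omega)
      have h1 := Submodule.finrank_sup_add_finrank_inf_eq (B ⊓ W₁) E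
      have h2 := Submodule.finrank_mono
        (sup_le (inf_le_inf_right W₁ (hℱX B hB)) hEX)
      have h3 : B ⊓ W₁ ⊓ E = ⊥ := by rw [inf_right_comm, hBE, bot_inf_eq]
      rw [h3, finrank_bot, (hmem B hB).2] at h1
      have h4 := Submodule.finrank_mono (inf_le_inf_right W₁ (hℱX B hB))
      rw [(hmem B hB).2] at h4
      omega
end
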